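/- Let μ be a measure (finitely supported, nonnegative) on ℤ × ℤ with μ(Γ) ≠ 0, (D₁μ)(Γ) ≠ 0 and (D₀D₁μ)(Γ) ≠ 0. Then E_{D₀D₁μ}[b] = ((D₁μ)(Γ)/(D₀D₁μ)(Γ)) · ( (m+n+1)·E_{D₁μ}[b] − 2·Cov_{D₁μ}(b, a−b) ). -/

import Mathlib

open Finsupp Filter

noncomputable section

/-- Signed-sum convention: `signedSum c k = Σ_{i=0}^{k} c i`, which is the ordinary sum for
`k ≥ 0`, is `0` for `k = -1`, and equals `-(c (-1) + c (-2) + ⋯ + c (k+1))` for `k ≤ -2`. -/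
def signedSum {M : Type*} [AddCommGroup M] (c : ℤ → M) (k : ℤ) : M :=
  (∑ i ∈ Finset.range (k + 1).toNat, c i) -
    ∑ i ∈ Finset.range (-(k + 1)).toNat, c (-((i : ℤ) + 1))

/-- The Demazure operator `D₀` (relative to `Λ = mΛ₀ + nΛ₁`):
`D₀ δ_{(a,b)} = Σ_{i=0}^{m - 2(a-b)} δ_{(a+i,b)}`, extended ℤ-linearly. -/
def D0 (m : ℕ) (μ : ℤ × ℤ →₀ ℤ) : ℤ × ℤ →₀ ℤ :=
  μ.sum fun p c =>
    c • signedSum (fun i => Finsupp.single (p.1 + i, p.2) (1 : ℤ)) ((m : ℤ) - 2 * (p.1 - p.2))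

/-- The Demazure operator `D₁` (relative to `Λ = mΛ₀ + nΛ₁`):
`D₁ δ_{(a,b)} = Σ_{i=0}^{n + 2(a-b)} δ_{(a,b+i)}`, extended ℤ-linearly. -/
def D1 (n : ℕ) (μ : ℤ × ℤ →₀ ℤ) : ℤ × ℤ →₀ ℤ :=
  μ.sum fun p c =>
    c • signedSum (fun i => Finsupp.single (p.1, p.2 + i) (1 : ℤ)) ((n : ℤ) + 2 * (p.1 - p.2))

/-- Total mass `μ(Γ)` of a finitely supported function on `ℤ × ℤ`. -/
def mass (μ : ℤ × ℤ →₀ ℤ) : ℤ := μ.sum fun _ c => c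

/-- Expected value `E_ν[f] = (1/ν(Γ)) Σ ν(a,b) f(a,b)`. -/
def expVal (ν : ℤ × ℤ →₀ ℤ) (f : ℤ × ℤ → ℚ) : ℚ :=
  (mass ν : ℚ)⁻¹ * ν.sum fun p c => (c : ℚ) * f p

/-- Covariance `Cov_ν(f,g) = E_ν[f·g] - E_ν[f]·E_ν[g]`. -/
def cov (ν : ℤ × ℤ →₀ ℤ) (f g : ℤ × ℤ → ℚ) : ℚ :=
  expVal ν (fun p => f p * g p) - expVal ν f * expVal ν g

/-- Variance `Var_ν(f) = Cov_ν(f,f)`. -/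
def var (ν : ℤ × ℤ →₀ ℤ) (f : ℤ × ℤ → ℚ) : ℚ := cov ν f f

/-- The coordinate function `a` (the degree). -/
def fa : ℤ × ℤ → ℚ := fun p => (p.1 : ℚ)

/-- The coordinate function `b`. -/
def fb : ℤ × ℤ → ℚ := fun p => (p.2 : ℚ)

/-- The finite-weight coordinate `a - b`. -/
def fab : ℤ × ℤ → ℚ := fun p => (p.1 : ℚ) - (p.2 : ℚ)

/-- `μ_{N,0}`: start from `δ_{(0,0)}`, apply `D₀` at odd steps and `D₁` at even steps. -/
def mu0 (m n : ℕ) : ℕ → (ℤ × ℤ →₀ ℤ)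
  | 0 => Finsupp.single (0, 0) 1
  | N + 1 => if N % 2 = 0 then D0 m (mu0 m n N) else D1 n (mu0 m n N)

/-- `μ_{N,1}`: start from `δ_{(0,0)}`, apply `D₁` at odd steps and `D₀` at even steps. -/
def mu1 (m n : ℕ) : ℕ → (ℤ × ℤ →₀ ℤ)
  | 0 => Finsupp.single (0, 0) 1
  | N + 1 => if N % 2 = 0 then D1 n (mu1 m n N) else D0 m (mu1 m n N)

/-- The unnormalized integral `Σ ν(p) f(p)` as an additive homomorphism in `ν`. -/
def integralHom (f : ℤ × ℤ → ℚ) : (ℤ × ℤ →₀ ℤ) →+ ℚ :=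
  (Finsupp.linearCombination ℤ f).toAddMonoidHom

theorem integralHom_apply (f : ℤ × ℤ → ℚ) (ν : ℤ × ℤ →₀ ℤ) :
    integralHom f ν = ν.sum fun p c => (c : ℚ) * f p := by
  simp [integralHom, Finsupp.linearCombination_apply]

theorem integralHom_single_one (f : ℤ × ℤ → ℚ) (p : ℤ × ℤ) :
    integralHom f (Finsupp.single p 1) = f p := by
  simp [integralHom]

theorem integralHom_add (f g : ℤ × ℤ → ℚ) (ν : ℤ × ℤ →₀ ℤ) :
    integralHom (fun p => f p + g p) ν = integralHom f ν + integralHom g ν := by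
  simp only [integralHom_apply, mul_add, Finsupp.sum_add]

theorem integralHom_const_mul (r : ℚ) (f : ℤ × ℤ → ℚ) (ν : ℤ × ℤ →₀ ℤ) :
    integralHom (fun p => r * f p) ν = r * integralHom f ν := by
  simp only [integralHom_apply, Finsupp.mul_sum, mul_left_comm]

theorem integralHom_one (ν : ℤ × ℤ →₀ ℤ) : integralHom (fun _ => 1) ν = mass ν := by
  simp [integralHom_apply, mass, Finsupp.sum]

theorem expVal_eq (ν : ℤ × ℤ →₀ ℤ) (f : ℤ × ℤ → ℚ) :
    expVal ν f = (mass ν : ℚ)⁻¹ * integralHom f ν := by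
  rw [integralHom_apply, expVal]

theorem map_signedSum {M N : Type*} [AddCommGroup M] [AddCommGroup N] (φ : M →+ N)
    (c : ℤ → M) (k : ℤ) : φ (signedSum c k) = signedSum (fun i => φ (c i)) k := by
  simp [signedSum, map_sum]

theorem signedSum_affine (x y : ℚ) (k : ℤ) :
    signedSum (fun i => x + y * (i : ℚ)) k = (k + 1) * x + y * (k * (k + 1) / 2) := by
  have hp (t : ℕ) : ∑ i ∈ Finset.range t, (x + y * (((i : ℕ) : ℤ) : ℚ)) =
      t * x + y * (t * (t - 1) / 2) := by
    induction t with
    | zero => simp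
    | succ t ih => rw [Finset.sum_range_succ, ih]; push_cast; ring
  have hn (t : ℕ) : ∑ i ∈ Finset.range t, (x + y * ((-(((i : ℕ) : ℤ) + 1) : ℤ) : ℚ)) =
      t * x - y * (t * (t + 1) / 2) := by
    induction t with
    | zero => simp
    | succ t ih => rw [Finset.sum_range_succ, ih]; push_cast; ring
  rw [signedSum, hp, hn]
  obtain ⟨t, ht | ht⟩ := Int.eq_nat_or_neg (k + 1)
  · have hk : (k : ℚ) = t - 1 := by rw [eq_sub_iff_add_eq]; exact_mod_cast ht
    simp only [ht, hk, Int.toNat_natCast, Int.toNat_neg_natCast, CharP.cast_eq_zero]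
    ring
  · have hk : (k : ℚ) = -t - 1 := by rw [eq_sub_iff_add_eq]; exact_mod_cast ht
    simp only [ht, hk, neg_neg, Int.toNat_natCast, Int.toNat_neg_natCast, CharP.cast_eq_zero]
    ring

theorem integralHom_D0 (m : ℕ) (f : ℤ × ℤ → ℚ) (ν : ℤ × ℤ →₀ ℤ) :
    integralHom f (D0 m ν) = integralHom
      (fun p => signedSum (fun i => f (p.1 + i, p.2)) ((m : ℤ) - 2 * (p.1 - p.2))) ν := by
  rw [D0, map_finsuppSum, integralHom_apply _ ν]
  simp only [map_zsmul, map_signedSum, integralHom_single_one, zsmul_eq_mul]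

theorem integralHom_D1 (n : ℕ) (f : ℤ × ℤ → ℚ) (ν : ℤ × ℤ →₀ ℤ) :
    integralHom f (D1 n ν) = integralHom
      (fun p => signedSum (fun i => f (p.1, p.2 + i)) ((n : ℤ) + 2 * (p.1 - p.2))) ν := by
  rw [D1, map_finsuppSum, integralHom_apply _ ν]
  simp only [map_zsmul, map_signedSum, integralHom_single_one, zsmul_eq_mul]

/-- `D₁ μ` is symmetric under the reflection `s₁`, so `⟨·, α₁∨⟩` integrates to zero. -/
theorem integralHom_coroot_D1 (n : ℕ) (μ : ℤ × ℤ →₀ ℤ) :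
    (n : ℚ) * mass (D1 n μ) + 2 * integralHom fab (D1 n μ) = 0 := by
  rw [← integralHom_one, ← integralHom_const_mul, ← integralHom_const_mul, ← integralHom_add,
    integralHom_D1]
  have hzero (p : ℤ × ℤ) : signedSum (fun i => (n : ℚ) * 1 + 2 * fab (p.1, p.2 + i))
      ((n : ℤ) + 2 * (p.1 - p.2)) = 0 := by
    have haff : (fun i : ℤ => (n : ℚ) * 1 + 2 * fab (p.1, p.2 + i)) =
        fun i : ℤ => ((n : ℚ) + 2 * (p.1 - p.2)) + (-2) * (i : ℚ) := by
      funext i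
      simp only [fab]
      push_cast
      ring
    rw [haff, signedSum_affine]
    push_cast
    ring
  simp only [hzero, integralHom_apply, mul_zero, Finsupp.sum_fun_zero]

/-- `D₀` preserves `b`, so it multiplies its contribution by the length of each string. -/
theorem integralHom_fb_D0 (m : ℕ) (ν : ℤ × ℤ →₀ ℤ) :
    integralHom fb (D0 m ν) =
      ((m : ℚ) + 1) * integralHom fb ν - 2 * integralHom (fun p => fb p * fab p) ν := by
  rw [integralHom_D0, sub_eq_add_neg, ← neg_mul, ← integralHom_const_mul,
    ← integralHom_const_mul, ← integralHom_add]
  congr 2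
  funext p
  have haff := signedSum_affine (p.2 : ℚ) 0 ((m : ℤ) - 2 * (p.1 - p.2))
  simp only [zero_mul, add_zero] at haff
  simp only [fb, fab]
  rw [haff]
  push_cast
  ring

/-- `E_{D₀D₁μ}[b] = ((D₁μ)(Γ)/(D₀D₁μ)(Γ))((m+n+1)E_{D₁μ}[b] - 2Cov_{D₁μ}(b,a-b))`. -/
theorem stmt_8 (m n : ℕ) (μ : ℤ × ℤ →₀ ℤ) (hpos : ∀ p, 0 ≤ μ p)
    (h0 : mass μ ≠ 0) (h1 : mass (D1 n μ) ≠ 0) (h2 : mass (D0 m (D1 n μ)) ≠ 0) :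
    expVal (D0 m (D1 n μ)) fb =
      (mass (D1 n μ) : ℚ) / (mass (D0 m (D1 n μ)) : ℚ) *
        (((m : ℚ) + (n : ℚ) + 1) * expVal (D1 n μ) fb - 2 * cov (D1 n μ) fb fab) := by
  have hmass : (mass (D1 n μ) : ℚ) ≠ 0 := Int.cast_ne_zero.mpr h1
  have hmass' : (mass (D0 m (D1 n μ)) : ℚ) ≠ 0 := Int.cast_ne_zero.mpr h2
  have hcoroot := integralHom_coroot_D1 n μ
  simp only [cov, expVal_eq, integralHom_fb_D0]
  field_simp
  linear_combination (-integralHom fb (D1 n μ)) * hcoroot
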